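/- arXiv:2110.00629 — 2 statements merged into one kernel-verified Lean document; each statement's English description precedes it below -/
import Mathlib

section
/- Assume the cost tensor C has nonnegative entries. Let (ε_k)_k be a sequence with ε_k → ∞, and for each k let P_{ε_k} be a minimizer of MMOT-DC_{ε_k}((T_m)_{m=1}^M, μ). If P_{ε_k} converges to some tensor P̃, then P̃ = P̃_{#T} (so P̃ ∈ F_M) and P̃ is a minimizer of F-MMOT((T_m)_{m=1}^M, μ). -/
open scoped BigOperators

namespace MMOTPaper

variable {N M : ℕ}

/-- Frobenius inner product of two tensors. -/
def inner' {ι : Type*} [Fintype ι] (C P : ι → ℝ) : ℝ := ∑ x, C x * P x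

/-- A probability tensor: nonnegative entries summing to 1. -/
def IsProb {ι : Type*} [Fintype ι] (P : ι → ℝ) : Prop :=
  (∀ x, 0 ≤ P x) ∧ ∑ x, P x = 1

/-- Negative entropy `H(P) = ∑ P log P`. -/
noncomputable def negEnt {ι : Type*} [Fintype ι] (P : ι → ℝ) : ℝ :=
  ∑ x, P x * Real.log (P x)

/-- Kullback-Leibler divergence; `⊤` if `μ` is not absolutely continuous w.r.t. `ν`. -/
noncomputable def KL {ι : Type*} [Fintype ι] (μ ν : ι → ℝ) : EReal :=
  if ∀ x, ν x = 0 → μ x = 0 then ((∑ x, μ x * Real.log (μ x / ν x) : ℝ) : EReal)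
  else ⊤

/-- `n`-th marginal vector of a tensor. -/
def marg1 (a : Fin N → ℕ) (P : ((n : Fin N) → Fin (a n)) → ℝ) (n : Fin N)
    (i : Fin (a n)) : ℝ :=
  ∑ x : (n : Fin N) → Fin (a n), if x n = i then P x else 0

/-- The set `U_T` of admissible couplings: probability tensors with marginals `μ n`. -/
def UT (a : Fin N → ℕ) (μ : (n : Fin N) → Fin (a n) → ℝ) :
    Set (((n : Fin N) → Fin (a n)) → ℝ) :=
  {P | IsProb P ∧ ∀ n i, marg1 a P n i = μ n i}

/-- A tuple partition of `(1,…,N)` into `M` blocks, encoded by the block assignment map: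
monotonicity says the blocks are tuples of consecutive indices concatenating to `T`,
surjectivity says each block is nonempty. -/
def IsPartition (part : Fin N → Fin M) : Prop :=
  Monotone part ∧ Function.Surjective part

/-- Restriction of a full index to the coordinates of block `m`. -/
def restr (a : Fin N → ℕ) (part : Fin N → Fin M) (m : Fin M)
    (x : (n : Fin N) → Fin (a n)) : (n : {n : Fin N // part n = m}) → Fin (a n.1) :=
  fun n => x n.1

/-- The `T_m`-marginal tensor `P_{#m}` of `P`: sum over all dimensions not in block `m`. -/
def margBlock (a : Fin N → ℕ) (part : Fin N → Fin M) (m : Fin M)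
    (P : ((n : Fin N) → Fin (a n)) → ℝ)
    (y : (n : {n : Fin N // part n = m}) → Fin (a n.1)) : ℝ :=
  ∑ x : (n : Fin N) → Fin (a n), if restr a part m x = y then P x else 0

/-- Tensor product of block tensors. -/
def tprod (a : Fin N → ℕ) (part : Fin N → Fin M)
    (Q : (m : Fin M) → ((n : {n : Fin N // part n = m}) → Fin (a n.1)) → ℝ)
    (x : (n : Fin N) → Fin (a n)) : ℝ :=
  ∏ m, Q m (restr a part m x)

/-- `P_{#T}`: the tensor product of the block marginals of `P`. -/
def prodMarg (a : Fin N → ℕ) (part : Fin N → Fin M)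
    (P : ((n : Fin N) → Fin (a n)) → ℝ) : ((n : Fin N) → Fin (a n)) → ℝ :=
  tprod a part (fun m => margBlock a part m P)

/-- The product tensor `μ_1 ⊗ … ⊗ μ_N`. -/
def prodMu (a : Fin N → ℕ) (μ : (n : Fin N) → Fin (a n) → ℝ)
    (x : (n : Fin N) → Fin (a n)) : ℝ :=
  ∏ n, μ n (x n)

/-- The set `F_M` of admissible couplings factorizing as a tensor product
of probability tensors indexed by the blocks. -/
def FM (a : Fin N → ℕ) (μ : (n : Fin N) → Fin (a n) → ℝ) (part : Fin N → Fin M) :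
    Set (((n : Fin N) → Fin (a n)) → ℝ) :=
  {P | P ∈ UT a μ ∧
    ∃ Q : (m : Fin M) → ((n : {n : Fin N // part n = m}) → Fin (a n.1)) → ℝ,
      (∀ m, IsProb (Q m)) ∧ P = tprod a part Q}

/-- The MMOT value `inf_{P ∈ U_T} ⟨C, P⟩`. -/
noncomputable def MMOTval (a : Fin N → ℕ) (μ : (n : Fin N) → Fin (a n) → ℝ)
    (C : ((n : Fin N) → Fin (a n)) → ℝ) : ℝ :=
  sInf ((fun P => inner' C P) '' UT a μ)

/-- The F-MMOT value `inf_{P ∈ F_M} ⟨C, P⟩`. -/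
noncomputable def FMMOTval (a : Fin N → ℕ) (μ : (n : Fin N) → Fin (a n) → ℝ)
    (part : Fin N → Fin M) (C : ((n : Fin N) → Fin (a n)) → ℝ) : ℝ :=
  sInf ((fun P => inner' C P) '' FM a μ part)

/-- The MMOT-DC objective `⟨C, P⟩ + ε KL(P | P_{#T})`. -/
noncomputable def dcObj (a : Fin N → ℕ) (part : Fin N → Fin M)
    (C : ((n : Fin N) → Fin (a n)) → ℝ) (ε : ℝ)
    (P : ((n : Fin N) → Fin (a n)) → ℝ) : EReal :=
  ((inner' C P : ℝ) : EReal) + (ε : EReal) * KL P (prodMarg a part P)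

/-- The MMOT-DC value `inf_{P ∈ U_T} ⟨C, P⟩ + ε KL(P | P_{#T})`. -/
noncomputable def MMOTDCval (a : Fin N → ℕ) (μ : (n : Fin N) → Fin (a n) → ℝ)
    (part : Fin N → Fin M) (C : ((n : Fin N) → Fin (a n)) → ℝ) (ε : ℝ) : EReal :=
  ⨅ P ∈ UT a μ, dcObj a part C ε P

/-- A full index is the same as a family of block indices. -/
def blockEquiv (a : Fin N → ℕ) (part : Fin N → Fin M) :
    ((n : Fin N) → Fin (a n)) ≃
      ((m : Fin M) → (n : {n : Fin N // part n = m}) → Fin (a n.1)) where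
  toFun x m := restr a part m x
  invFun Y n := Y (part n) ⟨n, rfl⟩
  left_inv x := rfl
  right_inv Y := by
    funext m n
    obtain ⟨n, rfl⟩ := n
    rfl

theorem sum_tprod (a : Fin N → ℕ) (part : Fin N → Fin M)
    (Q : (m : Fin M) → ((n : {n : Fin N // part n = m}) → Fin (a n.1)) → ℝ) :
    ∑ x, tprod a part Q x = ∏ m, ∑ y, Q m y := by
  rw [Finset.prod_univ_sum, Fintype.piFinset_univ]
  exact Fintype.sum_equiv (blockEquiv a part) _ _ (fun x => rfl)

theorem margBlock_tprod (a : Fin N → ℕ) (part : Fin N → Fin M)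
    (Q : (m : Fin M) → ((n : {n : Fin N // part n = m}) → Fin (a n.1)) → ℝ)
    (hQ : ∀ m, IsProb (Q m)) (m : Fin M) :
    margBlock a part m (tprod a part Q) = Q m := by
  funext y
  have h := sum_tprod a part
    (Function.update Q m (fun y' => if y' = y then Q m y' else 0))
  have h1 : ∏ m', ∑ y', (Function.update Q m (fun y' => if y' = y then Q m y' else 0)) m' y'
      = Q m y := by
    rw [Finset.prod_eq_single m]
    · simp
    · intro b _ hb
      simp [Function.update_of_ne hb, (hQ b).2]
    · simp
  rw [h1] at h
  rw [← h]
  unfold margBlock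
  refine Finset.sum_congr rfl fun x _ => ?_
  unfold tprod
  rw [← Finset.mul_prod_erase Finset.univ _ (Finset.mem_univ m),
    ← Finset.mul_prod_erase Finset.univ (fun m' => Function.update Q m _ m' _) (Finset.mem_univ m)]
  have h2 : ∏ m' ∈ Finset.univ.erase m, Function.update Q m
      (fun y' => if y' = y then Q m y' else 0) m' (restr a part m' x)
      = ∏ m' ∈ Finset.univ.erase m, Q m' (restr a part m' x) := by
    refine Finset.prod_congr rfl fun b hb => ?_
    rw [Function.update_of_ne (Finset.ne_of_mem_erase hb)]
  rw [h2, Function.update_self]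
  split_ifs <;> simp

theorem margBlock_prob (a : Fin N → ℕ) (part : Fin N → Fin M) (m : Fin M)
    (P : ((n : Fin N) → Fin (a n)) → ℝ) (hP : IsProb P) :
    IsProb (margBlock a part m P) := by
  refine ⟨fun y => Finset.sum_nonneg fun x _ => ?_, ?_⟩
  · split_ifs
    exacts [hP.1 x, le_rfl]
  · unfold margBlock
    rw [Finset.sum_comm]
    simpa using hP.2

theorem tprod_prob (a : Fin N → ℕ) (part : Fin N → Fin M)
    (Q : (m : Fin M) → ((n : {n : Fin N // part n = m}) → Fin (a n.1)) → ℝ)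
    (hQ : ∀ m, IsProb (Q m)) : IsProb (tprod a part Q) := by
  refine ⟨fun x => Finset.prod_nonneg fun m _ => (hQ m).1 _, ?_⟩
  rw [sum_tprod]
  exact Finset.prod_eq_one fun m _ => (hQ m).2

theorem marg1_eq (a : Fin N → ℕ) (part : Fin N → Fin M)
    (P : ((n : Fin N) → Fin (a n)) → ℝ) (n : Fin N) (i : Fin (a n)) :
    marg1 a P n i = ∑ y : (n' : {n' : Fin N // part n' = part n}) → Fin (a n'.1),
      if y ⟨n, rfl⟩ = i then margBlock a part (part n) P y else 0 := by
  unfold marg1 margBlock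
  have : ∀ y : (n' : {n' : Fin N // part n' = part n}) → Fin (a n'.1),
      (if y ⟨n, rfl⟩ = i then
        ∑ x : (n : Fin N) → Fin (a n), (if restr a part (part n) x = y then P x else 0) else 0)
      = ∑ x : (n : Fin N) → Fin (a n), (if restr a part (part n) x = y then
          (if x n = i then P x else 0) else 0) := by
    intro y
    have hx : ∀ x : (n : Fin N) → Fin (a n), restr a part (part n) x = y →
        x n = y ⟨n, rfl⟩ := by
      rintro x rfl
      rfl
    split_ifs with h
    · refine Finset.sum_congr rfl fun x _ => ?_
      split_ifs with h1 h2 <;> first | rfl | exact absurd ((hx x h1).trans h) h2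
    · symm
      refine Finset.sum_eq_zero fun x _ => ?_
      split_ifs with h1 h2 <;> first | rfl | exact absurd ((hx x h1).symm.trans h2) h
  simp_rw [this]
  rw [Finset.sum_comm]
  simp

theorem prodMarg_mem_FM (a : Fin N → ℕ) (μ : (n : Fin N) → Fin (a n) → ℝ)
    (part : Fin N → Fin M) (P : ((n : Fin N) → Fin (a n)) → ℝ) (hP : P ∈ UT a μ) :
    prodMarg a part P ∈ FM a μ part := by
  have hm := fun m => margBlock_prob a part m P hP.1
  refine ⟨⟨tprod_prob a part _ hm, fun n i => ?_⟩, _, hm, rfl⟩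
  rw [← hP.2 n i, marg1_eq a part, marg1_eq a part]
  unfold prodMarg
  rw [margBlock_tprod a part _ hm]

theorem prodMarg_of_FM (a : Fin N → ℕ) (μ : (n : Fin N) → Fin (a n) → ℝ)
    (part : Fin N → Fin M) (P : ((n : Fin N) → Fin (a n)) → ℝ) (hP : P ∈ FM a μ part) :
    prodMarg a part P = P := by
  obtain ⟨_, Q, hQ, rfl⟩ := hP
  unfold prodMarg
  congr 1
  funext m
  rw [margBlock_tprod a part Q hQ]

theorem dcObj_of_FM (a : Fin N → ℕ) (μ : (n : Fin N) → Fin (a n) → ℝ)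
    (part : Fin N → Fin M) (C : ((n : Fin N) → Fin (a n)) → ℝ) (e : ℝ)
    (P : ((n : Fin N) → Fin (a n)) → ℝ) (hP : P ∈ FM a μ part) :
    dcObj a part C e P = ((inner' C P : ℝ) : EReal) := by
  unfold dcObj KL
  rw [prodMarg_of_FM a μ part P hP, if_pos (fun _ h => h)]
  have : ∑ x, P x * Real.log (P x / P x) = 0 := by
    refine Finset.sum_eq_zero fun x _ => ?_
    by_cases h : P x = 0 <;> simp [h]
  rw [this]
  simp

theorem abs_cont (a : Fin N → ℕ) (part : Fin N → Fin M)
    (P : ((n : Fin N) → Fin (a n)) → ℝ) (hP : IsProb P) (x) (hx : prodMarg a part P x = 0) :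
    P x = 0 := by
  unfold prodMarg tprod at hx
  obtain ⟨m, -, hm⟩ := Finset.prod_eq_zero_iff.1 hx
  unfold margBlock at hm
  rw [Finset.sum_eq_zero_iff_of_nonneg] at hm
  · simpa using hm x (Finset.mem_univ x)
  · intro z _
    split_ifs
    exacts [hP.1 z, le_rfl]

theorem hellinger_pt (p q : ℝ) (hp : 0 ≤ p) (hq : 0 ≤ q) (h : q = 0 → p = 0) :
    p - q + (√p - √q) ^ 2 ≤ p * Real.log (p / q) := by
  have e1 := Real.sq_sqrt hp
  have e2 := Real.sq_sqrt hq
  rcases hp.eq_or_lt with rfl | hp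
  · simp [e2]
  have hq : 0 < q := lt_of_le_of_ne hq fun h0 => hp.ne' (h h0.symm)
  have sp := Real.sqrt_pos.2 hp
  have sq := Real.sqrt_pos.2 hq
  have hl : Real.log (p / q) = - 2 * Real.log (√q / √p) := by
    rw [Real.log_div hp.ne' hq.ne', Real.log_div sq.ne' sp.ne', Real.log_sqrt hp.le,
      Real.log_sqrt hq.le]
    ring
  have hle := Real.log_le_sub_one_of_pos (div_pos sq sp)
  have h3 : p * (√q / √p) = √p * √q := by
    nth_rewrite 1 [← e1]
    field_simp
  rw [hl]
  nlinarith [mul_le_mul_of_nonneg_left hle hp.le]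

theorem hellinger_le {ι : Type*} [Fintype ι] (p q : ι → ℝ) (hp : IsProb p) (hq : IsProb q)
    (h : ∀ x, q x = 0 → p x = 0) :
    ∑ x, (√(p x) - √(q x)) ^ 2 ≤ ∑ x, p x * Real.log (p x / q x) := by
  have := Finset.sum_le_sum fun x (_ : x ∈ Finset.univ) =>
    hellinger_pt (p x) (q x) (hp.1 x) (hq.1 x) (h x)
  rw [Finset.sum_add_distrib, Finset.sum_sub_distrib, hp.2, hq.2] at this
  linarith

theorem continuous_prodMarg (a : Fin N → ℕ) (part : Fin N → Fin M) :
    Continuous (prodMarg a part) := by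
  refine continuous_pi fun x => ?_
  unfold prodMarg tprod margBlock
  refine continuous_finsetProd _ fun m _ => continuous_finsetSum _ fun z _ => ?_
  split_ifs
  · exact continuous_apply z
  · exact continuous_const

theorem isClosed_UT (a : Fin N → ℕ) (μ : (n : Fin N) → Fin (a n) → ℝ) :
    IsClosed (UT a μ) := by
  have : UT a μ = (⋂ x, {P | 0 ≤ P x}) ∩ {P | ∑ x, P x = 1} ∩
      ⋂ n, ⋂ i, {P | marg1 a P n i = μ n i} := by
    ext P
    simp [UT, IsProb]
  rw [this]
  refine ((isClosed_iInter fun x => isClosed_le continuous_const (continuous_apply x)).inter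
    (isClosed_eq (by fun_prop) continuous_const)).inter
    (isClosed_iInter fun n => isClosed_iInter fun i => isClosed_eq ?_ continuous_const)
  unfold marg1
  refine continuous_finsetSum _ fun z _ => ?_
  split_ifs
  · exact continuous_apply z
  · exact continuous_const

/-- If `C ≥ 0`, `ε_k → ∞`, each `P k` is a minimizer of
`MMOT-DC_{ε_k}` and `P k → P̃`, then `P̃ = P̃_{#T}` (so `P̃ ∈ F_M`) and
`P̃` is a minimizer of `F-MMOT`. -/
theorem cluster_point_minimizes_fmmot {N M : ℕ} (hN : 0 < N) (hM : 0 < M)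
    (a : Fin N → ℕ) (ha : ∀ n, 0 < a n)
    (μ : (n : Fin N) → Fin (a n) → ℝ) (hμ : ∀ n, IsProb (μ n))
    (part : Fin N → Fin M) (hpart : IsPartition part)
    (C : ((n : Fin N) → Fin (a n)) → ℝ) (hC : ∀ x, 0 ≤ C x)
    (ε : ℕ → ℝ) (hε : Filter.Tendsto ε Filter.atTop Filter.atTop)
    (P : ℕ → ((n : Fin N) → Fin (a n)) → ℝ)
    (hPmem : ∀ k, P k ∈ UT a μ)
    (hPmin : ∀ k, ∀ Q ∈ UT a μ, dcObj a part C (ε k) (P k) ≤ dcObj a part C (ε k) Q)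
    (Pt : ((n : Fin N) → Fin (a n)) → ℝ)
    (hlim : Filter.Tendsto P Filter.atTop (nhds Pt)) :
    Pt = prodMarg a part Pt ∧ Pt ∈ FM a μ part ∧
      ∀ Q ∈ FM a μ part, inner' C Pt ≤ inner' C Q := by
  have hU : Pt ∈ UT a μ :=
    (isClosed_UT a μ).mem_of_tendsto hlim (Filter.Eventually.of_forall hPmem)
  have hprob : ∀ R ∈ UT a μ, IsProb (prodMarg a part R) := fun R hR =>
    (prodMarg_mem_FM a μ part R hR).1.1
  have hac := fun k => abs_cont a part (P k) (hPmem k).1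
  -- the real form of minimality
  have hreal : ∀ k, ∀ Q ∈ FM a μ part, inner' C (P k) +
      ε k * ∑ x, P k x * Real.log (P k x / prodMarg a part (P k) x) ≤ inner' C Q := by
    intro k Q hQ
    have h := hPmin k Q hQ.1
    rw [dcObj_of_FM a μ part C _ Q hQ] at h
    unfold dcObj KL at h
    rw [if_pos (hac k)] at h
    exact_mod_cast h
  have hH := fun k => hellinger_le (P k) (prodMarg a part (P k)) (hPmem k).1
    (hprob _ (hPmem k)) (hac k)
  have hH0 : ∀ R S : ((n : Fin N) → Fin (a n)) → ℝ, 0 ≤ ∑ x, (√(R x) - √(S x)) ^ 2 :=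
    fun R S => Finset.sum_nonneg fun x _ => sq_nonneg _
  have hpos : ∀ᶠ k in Filter.atTop, 0 < ε k := hε.eventually_gt_atTop 0
  have hcont : Continuous fun R : ((n : Fin N) → Fin (a n)) → ℝ =>
      ∑ x, (√(R x) - √(prodMarg a part R x)) ^ 2 := by
    have := continuous_prodMarg a part
    fun_prop
  have hQ0 := prodMarg_mem_FM a μ part Pt hU
  have hzero : ∑ x, (√(Pt x) - √(prodMarg a part Pt x)) ^ 2 = 0 := by
    refine le_antisymm ?_ (hH0 _ _)
    refine le_of_tendsto_of_tendsto ((hcont.tendsto Pt).comp hlim)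
      (Filter.Tendsto.const_div_atTop hε (inner' C (prodMarg a part Pt))) ?_
    filter_upwards [hpos] with k hk
    have h0 : 0 ≤ inner' C (P k) :=
      Finset.sum_nonneg fun x _ => mul_nonneg (hC x) ((hPmem k).1.1 x)
    have h1 := hreal k _ hQ0
    have h2 := hH k
    rw [le_div_iff₀ hk]
    simp only [Function.comp]
    nlinarith
  have heq : Pt = prodMarg a part Pt := by
    funext x
    have h := (Finset.sum_eq_zero_iff_of_nonneg (fun x _ => sq_nonneg _)).1 hzero x
      (Finset.mem_univ x)
    have h := sub_eq_zero.1 (pow_eq_zero_iff (two_ne_zero)|>.1 h)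
    exact (Real.sqrt_inj (hU.1.1 x) ((hprob _ hU).1 x)).1 h
  refine ⟨heq, heq ▸ hQ0, fun Q hQ => ?_⟩
  have hci : Continuous fun R : ((n : Fin N) → Fin (a n)) → ℝ => inner' C R := by
    unfold inner'
    fun_prop
  refine le_of_tendsto ((hci.tendsto Pt).comp hlim) ?_
  filter_upwards [hpos] with k hk
  have h1 := hreal k Q hQ
  have h2 := mul_nonneg hk.le ((hH0 _ _).trans (hH k))
  simp only [Function.comp]
  linarith

end MMOTPaper
end

section
/- MMOT-DC_ε((T_m)_{m=1}^M, μ) → MMOT(μ) as ε → 0+. -/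
open scoped BigOperators

namespace MMOTPaper

variable {N M : ℕ}

lemma margBlock_nonneg (a : Fin N → ℕ) (part : Fin N → Fin M) (m : Fin M)
    (P : ((n : Fin N) → Fin (a n)) → ℝ) (hP : ∀ x, 0 ≤ P x)
    (y : (n : {n : Fin N // part n = m}) → Fin (a n.1)) : 0 ≤ margBlock a part m P y := by
  unfold margBlock
  refine Finset.sum_nonneg fun x _ => ?_
  split_ifs
  · exact hP x
  · exact le_rfl

lemma sum_margBlock (a : Fin N → ℕ) (part : Fin N → Fin M) (m : Fin M)
    (P : ((n : Fin N) → Fin (a n)) → ℝ) : ∑ y, margBlock a part m P y = ∑ x, P x := by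
  unfold margBlock
  rw [Finset.sum_comm]
  refine Finset.sum_congr rfl fun x _ => ?_
  simp

lemma prodMarg_nonneg (a : Fin N → ℕ) (part : Fin N → Fin M)
    (P : ((n : Fin N) → Fin (a n)) → ℝ) (hP : ∀ x, 0 ≤ P x) (x : (n : Fin N) → Fin (a n)) :
    0 ≤ prodMarg a part P x := by
  unfold prodMarg tprod
  exact Finset.prod_nonneg fun m _ => margBlock_nonneg a part m P hP _

lemma sum_prodMarg_le (a : Fin N → ℕ) (part : Fin N → Fin M)
    (P : ((n : Fin N) → Fin (a n)) → ℝ) (hP : IsProb P) : ∑ x, prodMarg a part P x ≤ 1 := by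
  have hinj : Function.Injective
      (fun (x : (n : Fin N) → Fin (a n)) (m : Fin M) => restr a part m x) := by
    intro x y h
    funext n
    exact congrFun (congrFun h (part n)) ⟨n, rfl⟩
  have h1 : ∏ m, ∑ y, margBlock a part m P y = 1 := by
    simp [sum_margBlock, hP.2]
  rw [Fintype.prod_sum] at h1
  rw [← h1]
  have h2 := Finset.sum_map Finset.univ ⟨_, hinj⟩
    (fun y : (m : Fin M) → ((n : {n : Fin N // part n = m}) → Fin (a n.1)) =>
      ∏ m, margBlock a part m P (y m))
  have h3 : ∑ x, prodMarg a part P x = ∑ x, ∏ m, margBlock a part m P (restr a part m x) := rfl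
  rw [h3]
  refine h2.symm.le.trans ?_
  refine Finset.sum_le_sum_of_subset_of_nonneg (Finset.subset_univ _) fun y _ _ => ?_
  exact Finset.prod_nonneg fun m _ => margBlock_nonneg a part m P hP.1 _

lemma prodMarg_ac (a : Fin N → ℕ) (part : Fin N → Fin M)
    (P : ((n : Fin N) → Fin (a n)) → ℝ) (hP : ∀ x, 0 ≤ P x) (x : (n : Fin N) → Fin (a n))
    (hx : prodMarg a part P x = 0) : P x = 0 := by
  unfold prodMarg tprod at hx
  obtain ⟨m, _, hm⟩ := Finset.prod_eq_zero_iff.1 hx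
  unfold margBlock at hm
  rw [Finset.sum_eq_zero_iff_of_nonneg] at hm
  · simpa using hm x (Finset.mem_univ _)
  · intro y _
    split_ifs
    · exact hP y
    · exact le_rfl

lemma kl_sum_nonneg {ι : Type*} [Fintype ι] (p q : ι → ℝ) (hp : ∀ x, 0 ≤ p x)
    (hq : ∀ x, 0 ≤ q x) (hs : ∑ x, q x ≤ ∑ x, p x) (hac : ∀ x, q x = 0 → p x = 0) :
    0 ≤ ∑ x, p x * Real.log (p x / q x) := by
  have key : ∀ x, p x - q x ≤ p x * Real.log (p x / q x) := by
    intro x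
    rcases (hp x).eq_or_lt with h | h
    · rw [← h]; simp [hq x]
    have hq0 : 0 < q x := lt_of_le_of_ne (hq x) fun h' => h.ne' (hac x h'.symm)
    have h1 := Real.one_sub_inv_le_log_of_pos (div_pos h hq0)
    have h2 := mul_le_mul_of_nonneg_left h1 h.le
    have h3 : p x * (1 - (p x / q x)⁻¹) = p x - q x := by field_simp
    linarith
  have := Finset.sum_le_sum fun x (_ : x ∈ Finset.univ) => key x
  rw [Finset.sum_sub_distrib] at this
  linarith

lemma prodMu_mem (a : Fin N → ℕ) (μ : (n : Fin N) → Fin (a n) → ℝ)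
    (hμ : ∀ n, IsProb (μ n)) : prodMu a μ ∈ UT a μ := by
  refine ⟨⟨fun x => Finset.prod_nonneg fun n _ => (hμ n).1 _, ?_⟩, fun n i => ?_⟩
  · unfold prodMu
    rw [← Fintype.prod_sum]
    simp [(hμ _).2]
  · unfold marg1 prodMu
    have h : ∀ x : (n : Fin N) → Fin (a n), (if x n = i then ∏ k, μ k (x k) else 0) =
        ∏ k, (if h : k = n then (if x k = h ▸ i then μ k (x k) else 0) else μ k (x k)) := by
      intro x
      split_ifs with hx
      · refine Finset.prod_congr rfl fun k _ => ?_
        by_cases hk : k = n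
        · subst hk; simp [hx]
        · simp [hk]
      · symm
        apply Finset.prod_eq_zero (Finset.mem_univ n)
        simp [hx]
    rw [Finset.sum_congr rfl fun x _ => h x]
    rw [← Fintype.prod_sum (fun k (j : Fin (a k)) =>
      (if h : k = n then (if j = h ▸ i then μ k j else 0) else μ k j))]
    rw [Finset.prod_eq_single n]
    · simp
    · intro k _ hk
      simp [hk, (hμ k).2]
    · simp

lemma exists_dcObj (a : Fin N → ℕ) (part : Fin N → Fin M)
    (C : ((n : Fin N) → Fin (a n)) → ℝ)
    (P : ((n : Fin N) → Fin (a n)) → ℝ) (hP : IsProb P) :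
    ∃ k : ℝ, 0 ≤ k ∧ ∀ ε : ℝ, dcObj a part C ε P = ((inner' C P + ε * k : ℝ) : EReal) := by
  refine ⟨_, kl_sum_nonneg P (prodMarg a part P) hP.1 (prodMarg_nonneg a part P hP.1)
    ((sum_prodMarg_le a part P hP).trans hP.2.ge) (prodMarg_ac a part P hP.1), fun ε => ?_⟩
  unfold dcObj KL
  rw [if_pos (prodMarg_ac a part P hP.1)]
  push_cast
  rfl

lemma bddBelow_inner (a : Fin N → ℕ) (μ : (n : Fin N) → Fin (a n) → ℝ)
    (C : ((n : Fin N) → Fin (a n)) → ℝ) : BddBelow ((fun P => inner' C P) '' UT a μ) := by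
  refine ⟨∑ x, -|C x|, ?_⟩
  rintro _ ⟨P, hP, rfl⟩
  refine Finset.sum_le_sum fun x _ => ?_
  have h0 := hP.1.1 x
  have h1 : P x ≤ 1 := by
    rw [← hP.1.2]
    exact Finset.single_le_sum (fun y _ => hP.1.1 y) (Finset.mem_univ x)
  have h2 : |C x * P x| ≤ |C x| := by
    rw [abs_mul, abs_of_nonneg h0]
    exact mul_le_of_le_one_right (abs_nonneg _) h1
  linarith [neg_abs_le (C x * P x)]

/-- `MMOT-DC_ε((T_m), μ) → MMOT(μ)` as `ε → 0⁺`. -/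
theorem mmotdc_tendsto_mmot {N M : ℕ} (hN : 0 < N) (hM : 0 < M)
    (a : Fin N → ℕ) (ha : ∀ n, 0 < a n)
    (μ : (n : Fin N) → Fin (a n) → ℝ) (hμ : ∀ n, IsProb (μ n))
    (part : Fin N → Fin M) (hpart : IsPartition part)
    (C : ((n : Fin N) → Fin (a n)) → ℝ) :
    Filter.Tendsto (fun ε : ℝ => MMOTDCval a μ part C ε)
      (nhdsWithin 0 (Set.Ioi 0)) (nhds ((MMOTval a μ C : ℝ) : EReal)) := by
  rw [tendsto_order]
  constructor
  · intro b hb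
    filter_upwards [self_mem_nhdsWithin] with ε hε
    refine hb.trans_le ?_
    refine le_iInf₂ fun P hP => ?_
    obtain ⟨k, hk, h⟩ := exists_dcObj a part C P hP.1
    rw [h, EReal.coe_le_coe_iff]
    have h1 : MMOTval a μ C ≤ inner' C P := csInf_le (bddBelow_inner a μ C) ⟨P, hP, rfl⟩
    have h2 : 0 ≤ ε * k := mul_nonneg (le_of_lt hε) hk
    linarith
  · intro b hb
    obtain ⟨c, hc1, hc2⟩ := EReal.lt_iff_exists_real_btwn.1 hb
    rw [EReal.coe_lt_coe_iff] at hc1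
    obtain ⟨_, ⟨P, hP, rfl⟩, hPc⟩ :=
      exists_lt_of_csInf_lt (Set.Nonempty.image _ ⟨_, prodMu_mem a μ hμ⟩) hc1
    obtain ⟨k, hk, h⟩ := exists_dcObj a part C P hP.1
    have ht : Filter.Tendsto (fun ε : ℝ => inner' C P + ε * k) (nhdsWithin 0 (Set.Ioi 0))
        (nhds (inner' C P)) := by
      have : Continuous (fun ε : ℝ => inner' C P + ε * k) := by fun_prop
      have h3 := this.tendsto 0
      simp only [zero_mul, add_zero] at h3
      exact h3.mono_left nhdsWithin_le_nhds
    filter_upwards [ht.eventually_lt_const hPc] with ε hε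
    refine lt_of_le_of_lt (iInf₂_le P hP) ?_
    rw [h]
    exact (EReal.coe_lt_coe_iff.2 hε).trans hc2

end MMOTPaper
end
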